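/- arXiv:2405.10974 — 2 statements merged into one kernel-verified Lean document; each statement's English description precedes it below -/
import Mathlib

section
/- Let n be a positive natural number, D a finite nonempty type (of documents), ι a finite type (of identifiers), x : D → EuclideanSpace ℝ (Fin n) a family of document vectors, μ : ι → EuclideanSpace ℝ (Fin n) a family of cluster centers, f : D → ι an assignment, Σ a symmetric positive-definite n × n real matrix, and σ > 0. For each document d, let p_d be the Gaussian density N(x_d, Σ) and for each identifier i let g_i be the Gaussian density N(μ_i, σ²I). Then the total distortion Σ_{d ∈ D} ∫ p_d(q) · log(p_d(q)/g_{f(d)}(q)) dq equals (1/(2σ²)) · Σ_{d ∈ D} ‖x_d − μ_{f(d)}‖² + |D| · ½ · ( n · log σ² − log (det Σ) − n + (trace Σ)/σ² ); in particular, it depends on the assignment f and the centers μ only through the k-means objective Σ_{d ∈ D} ‖x_d − μ_{f(d)}‖². -/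
noncomputable section

open scoped BigOperators

/-- The Gaussian density `N(μ, Σ)` at `x`:
`((2π)^n · det Σ)^(−1/2) · exp(−½ · ⟪x − μ, Σ⁻¹ (x − μ)⟫)`. -/
def gaussianDensity {n : ℕ} (μ : EuclideanSpace ℝ (Fin n))
    (S : Matrix (Fin n) (Fin n) ℝ) (x : EuclideanSpace ℝ (Fin n)) : ℝ :=
  ((2 * Real.pi) ^ n * S.det) ^ (-(1 / 2 : ℝ)) *
    Real.exp (-(1 / 2 : ℝ) * ∑ i, (x i - μ i) * (S⁻¹).mulVec (fun j => x j - μ j) i)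

/-- The isotropic Gaussian density `N(μ, σ²I)` at `x`:
`(2πσ²)^(−n/2) · exp(−‖x − μ‖²/(2σ²))`. -/
def isoGaussianDensity {n : ℕ} (μ : EuclideanSpace ℝ (Fin n)) (σ : ℝ)
    (x : EuclideanSpace ℝ (Fin n)) : ℝ :=
  (2 * Real.pi * σ ^ 2) ^ (-(n : ℝ) / 2) * Real.exp (-‖x - μ‖ ^ 2 / (2 * σ ^ 2))

open MeasureTheory ProbabilityTheory

namespace KM

abbrev phi : ℝ → ℝ := gaussianPDFReal 0 1

lemma int_iff (g : ℝ → ℝ) (h : Integrable g (gaussianReal 0 1)) :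
    Integrable (fun t => g t * phi t) := by
  rw [gaussianReal_of_var_ne_zero 0 one_ne_zero,
    integrable_withDensity_iff (measurable_gaussianPDF 0 1)
      (Filter.Eventually.of_forall fun x => by simp [gaussianPDF])] at h
  refine h.congr (Filter.Eventually.of_forall fun x => ?_)
  simp [gaussianPDF, phi, ENNReal.toReal_ofReal (gaussianPDFReal_nonneg 0 1 x)]

lemma int_eq (g : ℝ → ℝ) : ∫ t, g t * phi t = ∫ t, g t ∂(gaussianReal 0 1) := by
  rw [integral_gaussianReal_eq_integral_smul one_ne_zero]
  simp [phi, mul_comm]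

lemma i0 : Integrable phi := integrable_gaussianPDFReal 0 1
lemma m0 : ∫ t, phi t = 1 := integral_gaussianPDFReal_eq_one 0 one_ne_zero
lemma i1 : Integrable (fun t => t * phi t) := by
  apply int_iff (fun t => t)
  exact (memLp_id_gaussianReal 1).integrable (by simp)
lemma m1 : ∫ t, t * phi t = 0 := by
  rw [int_eq (fun t => t)]; simp
lemma i2 : Integrable (fun t => t * t * phi t) := by
  apply int_iff (fun t => t * t)
  have := (memLp_id_gaussianReal (μ := 0) (v := 1) 2).integrable_sq
  simpa [pow_two] using this
lemma m2 : ∫ t, t * t * phi t = 1 := by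
  rw [int_eq (fun t => t * t)]
  have h := variance_id_gaussianReal (μ := 0) (v := 1)
  rw [variance_eq_sub (memLp_id_gaussianReal 2)] at h
  simpa [pow_two] using h

variable {n : ℕ}

def w (z : Fin n → ℝ) : ℝ := ∏ k, phi (z k)

def ff (i j k : Fin n) (t : ℝ) : ℝ :=
  (if k = i then t else 1) * (if k = j then t else 1) * phi t

lemma prod_ff (i j : Fin n) (z : Fin n → ℝ) : ∏ k, ff i j k (z k) = z i * z j * w z := by
  simp only [ff, w, Finset.prod_mul_distrib]
  simp

lemma int_ff (i j k : Fin n) : Integrable (ff i j k) := by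
  unfold ff
  split_ifs
  · exact i2
  · simp only [mul_one]; exact i1
  · simp only [one_mul]; exact i1
  · simp only [one_mul]; exact i0

lemma integral_ff (i j : Fin n) : ∏ k, ∫ t, ff i j k t = if i = j then 1 else 0 := by
  split_ifs with h
  · subst h
    apply Finset.prod_eq_one
    intro k _
    by_cases h1 : k = i
    · simp only [ff, h1, if_true]; exact m2
    · simp only [ff, h1, if_false, one_mul]; exact m0
  · apply Finset.prod_eq_zero (Finset.mem_univ i)
    simp only [ff, h, if_true, if_false, mul_one]; exact m1

lemma I0 : Integrable (w (n := n)) := Integrable.fintype_prod (fun _ => i0)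
lemma M0 : ∫ z, w (n := n) z = 1 := by
  unfold w
  rw [integral_fintype_prod_volume_eq_prod (fun _ => phi)]
  simp [m0]
lemma I2 (i j : Fin n) : Integrable (fun z : Fin n → ℝ => z i * z j * w z) := by
  simp_rw [← prod_ff]
  exact Integrable.fintype_prod (fun k => int_ff i j k)
lemma M2 (i j : Fin n) : ∫ z : Fin n → ℝ, z i * z j * w z = if i = j then 1 else 0 := by
  simp_rw [← prod_ff]
  rw [integral_fintype_prod_volume_eq_prod, integral_ff]

lemma prod_gg (i : Fin n) (z : Fin n → ℝ) :
    ∏ k, ((if k = i then z k else 1) * phi (z k)) = z i * w z := by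
  simp only [w, Finset.prod_mul_distrib]
  simp
lemma I1 (i : Fin n) : Integrable (fun z : Fin n → ℝ => z i * w z) := by
  simp_rw [← prod_gg]
  refine Integrable.fintype_prod (f := fun k t => (if k = i then t else 1) * phi t) (fun k => ?_)
  by_cases h : k = i
  · simp only [h, if_true]; exact i1
  · simp only [h, if_false, one_mul]; exact i0
lemma M1 (i : Fin n) : ∫ z : Fin n → ℝ, z i * w z = 0 := by
  simp_rw [← prod_gg]
  rw [integral_fintype_prod_volume_eq_prod (fun k t => (if k = i then t else 1) * phi t)]
  apply Finset.prod_eq_zero (Finset.mem_univ i)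
  simp only [if_true]; exact m1

lemma poly (a : ℝ) (b : Fin n → ℝ) (C : Matrix (Fin n) (Fin n) ℝ) :
    ∫ z : Fin n → ℝ, w z * (a + ∑ i, b i * z i + ∑ i, ∑ j, C i j * (z i * z j)) = a + C.trace := by
  have e : ∀ z : Fin n → ℝ, w z * (a + ∑ i, b i * z i + ∑ i, ∑ j, C i j * (z i * z j)) =
      a * w z + ∑ i, b i * (z i * w z) + ∑ i, ∑ j, C i j * (z i * z j * w z) := by
    intro z
    simp only [mul_add, Finset.mul_sum]
    congr 1
    · congr 1
      · ring
      · exact Finset.sum_congr rfl fun i _ => by ring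
    · exact Finset.sum_congr rfl fun i _ => Finset.sum_congr rfl fun j _ => by ring
  simp_rw [e]
  have h0 : Integrable (fun z : Fin n → ℝ => a * w z) := I0.const_mul a
  have h1 : Integrable (fun z : Fin n → ℝ => ∑ i, b i * (z i * w z)) :=
    integrable_finsetSum _ fun i _ => (I1 i).const_mul _
  have h2' : ∀ i, Integrable (fun z : Fin n → ℝ => ∑ j, C i j * (z i * z j * w z)) := fun i =>
    integrable_finsetSum _ fun j _ => (I2 i j).const_mul _
  have h2 : Integrable (fun z : Fin n → ℝ => ∑ i, ∑ j, C i j * (z i * z j * w z)) :=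
    integrable_finsetSum _ fun i _ => h2' i
  have h01 : Integrable (fun z : Fin n → ℝ => a * w z + ∑ i, b i * (z i * w z)) := h0.add h1
  rw [integral_add h01 h2, integral_add h0 h1, integral_finsetSum _ (fun i _ => (I1 i).const_mul _),
    integral_finsetSum _ (fun i _ => h2' i), integral_const_mul, M0]
  simp_rw [integral_const_mul, M1]
  have : ∀ i, ∫ z : Fin n → ℝ, ∑ j, C i j * (z i * z j * w z) = C i i := by
    intro i
    rw [integral_finsetSum _ (fun j _ => (I2 i j).const_mul _)]
    simp_rw [integral_const_mul, M2]
    simp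
  simp [this, Matrix.trace]

lemma w_eq (z : Fin n → ℝ) :
    w z = (√(2 * Real.pi))⁻¹ ^ n * Real.exp (-(1/2 : ℝ) * ∑ i, z i * z i) := by
  simp only [w, phi, gaussianPDFReal, Finset.prod_mul_distrib, ← Real.exp_sum, Finset.mul_sum]
  congr 1
  · simp
  · congr 1
    exact Finset.sum_congr rfl fun i _ => by simp; ring

open scoped MatrixOrder in
lemma exists_sqrt (S : Matrix (Fin n) (Fin n) ℝ) (hS : S.PosDef) :
    ∃ A : Matrix (Fin n) (Fin n) ℝ, S = A * A.transpose := by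
  obtain ⟨B, hB⟩ := CStarAlgebra.nonneg_iff_eq_star_mul_self.1 hS.posSemidef.nonneg
  refine ⟨B.transpose, ?_⟩
  rw [hB, Matrix.star_eq_conjTranspose]
  simp

lemma change (A : Matrix (Fin n) (Fin n) ℝ) (hA : A.det ≠ 0) (x : EuclideanSpace ℝ (Fin n))
    (F : EuclideanSpace ℝ (Fin n) → ℝ) :
    ∫ q, F q = ∫ z : Fin n → ℝ, |A.det| * F (x + WithLp.toLp 2 (A.mulVec z)) := by
  rw [integral_const_mul]
  have h1 : ∫ q, F q = ∫ q, F (x + q) := (integral_add_left_eq_self F x).symm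
  have h2 := (EuclideanSpace.volume_preserving_symm_measurableEquiv_toLp (Fin n)).symm.integral_comp'
    (g := fun q => F (x + q))
  have h3 := Real.map_matrix_volume_pi_eq_smul_volume_pi hA
  have h4 : MeasurableEmbedding (Matrix.toLin' A) := by
    let e := (LinearEquiv.ofIsUnitDet (f := Matrix.toLin' A) (v := Pi.basisFun ℝ (Fin n)) (v' := Pi.basisFun ℝ (Fin n))
      (by simpa [LinearMap.toMatrix_eq_toMatrix'] using hA)).toContinuousLinearEquiv
    exact e.toHomeomorph.measurableEmbedding
  have h5 := h4.integral_map (μ := volume) (fun y => F (x + WithLp.toLp 2 y))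
  rw [h3, integral_smul_measure] at h5
  have h6 : (ENNReal.ofReal |A.det⁻¹|).toReal = |A.det|⁻¹ := by
    rw [ENNReal.toReal_ofReal (abs_nonneg _), abs_inv]
  rw [h6, smul_eq_mul] at h5
  simp only [Matrix.toLin'_apply] at h5
  rw [← h5, h1, ← mul_assoc, mul_inv_cancel₀ (abs_ne_zero.2 hA), one_mul, ← h2]
  rfl

lemma const_eq {s d : ℝ} (hd : d ≠ 0) (hs : s = d * d) :
    |d| * ((2 * Real.pi) ^ n * s) ^ (-(1 / 2 : ℝ)) = (√(2 * Real.pi))⁻¹ ^ n := by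
  have hp : (0:ℝ) < 2 * Real.pi := by positivity
  have e : (2 * Real.pi) ^ n * s = (√(2 * Real.pi) ^ n * |d|) ^ 2 := by
    rw [mul_pow (_ ^ n), sq_abs, ← pow_mul, mul_comm n 2, pow_mul, Real.sq_sqrt hp.le, hs]; ring
  rw [e, Real.rpow_neg (by positivity), ← Real.sqrt_eq_rpow, Real.sqrt_sq (by positivity)]
  have := abs_pos.2 hd
  rw [mul_inv, inv_pow]
  field_simp

lemma quad_eq (S A : Matrix (Fin n) (Fin n) ℝ) (hA : A.det ≠ 0) (hSA : S = A * A.transpose)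
    (z : Fin n → ℝ) :
    ∑ i, (A.mulVec z) i * (S⁻¹).mulVec (A.mulVec z) i = ∑ i, z i * z i := by
  change (A.mulVec z) ⬝ᵥ (S⁻¹).mulVec (A.mulVec z) = z ⬝ᵥ z
  have hu : IsUnit A.det := isUnit_iff_ne_zero.2 hA
  have hu' : IsUnit A.transpose.det := by rwa [Matrix.det_transpose]
  rw [hSA, Matrix.mul_inv_rev, Matrix.mulVec_mulVec, Matrix.mul_assoc, Matrix.nonsing_inv_mul _ hu,
    Matrix.mul_one, ← Matrix.vecMul_transpose, ← Matrix.dotProduct_mulVec, Matrix.mulVec_mulVec,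
    Matrix.mul_nonsing_inv _ hu', Matrix.one_mulVec]

lemma single (S : Matrix (Fin n) (Fin n) ℝ) (hS : S.PosDef) (σ : ℝ) (hσ : 0 < σ)
    (x μ : EuclideanSpace ℝ (Fin n)) :
    ∫ q : EuclideanSpace ℝ (Fin n), gaussianDensity x S q *
          Real.log (gaussianDensity x S q / isoGaussianDensity μ σ q) =
    (1 / (2 * σ ^ 2)) * ‖x - μ‖ ^ 2 + ((1 / 2 : ℝ) *
        ((n : ℝ) * Real.log (σ ^ 2) - Real.log S.det - (n : ℝ) + S.trace / σ ^ 2)) := by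
  obtain ⟨A, hSA⟩ := exists_sqrt S hS
  have hd : S.det = A.det * A.det := by rw [hSA, Matrix.det_mul, Matrix.det_transpose]
  have hpos := hS.det_pos
  have hA : A.det ≠ 0 := by rintro h; simp [hd, h] at hpos
  have hp : (0:ℝ) < 2 * Real.pi := by positivity
  rw [change A hA x]
  have hq : ∀ z : Fin n → ℝ, gaussianDensity x S (x + WithLp.toLp 2 (A.mulVec z)) =
      ((2 * Real.pi) ^ n * S.det) ^ (-(1 / 2 : ℝ)) * Real.exp (-(1/2 : ℝ) * ∑ i, z i * z i) := by
    intro z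
    rw [← quad_eq S A hA hSA z]
    simp [gaussianDensity]
  set v := x - μ with hv
  have key : ∀ z : Fin n → ℝ,
      |A.det| * (gaussianDensity x S (x + WithLp.toLp 2 (A.mulVec z)) *
        Real.log (gaussianDensity x S (x + WithLp.toLp 2 (A.mulVec z)) /
          isoGaussianDensity μ σ (x + WithLp.toLp 2 (A.mulVec z)))) =
      w z * (((1 / 2 : ℝ) * (n * Real.log (σ ^ 2) - Real.log S.det) + ‖v‖ ^ 2 / (2 * σ ^ 2)) +
        ∑ j, ((1 / σ ^ 2) * ∑ i, v i * A i j) * z j +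
        ∑ j, ∑ k, ((-(1/2 : ℝ)) • (1 : Matrix (Fin n) (Fin n) ℝ) +
          (1 / (2 * σ ^ 2)) • (A.transpose * A)) j k * (z j * z k)) := by
    intro z
    rw [← mul_assoc]
    congr 1
    · rw [hq, w_eq, ← mul_assoc, const_eq hA hd]
    · have hc : 0 < (2 * Real.pi) ^ n * S.det := by positivity
      have hc2 : 0 < 2 * Real.pi * σ ^ 2 := by positivity
      rw [hq, isoGaussianDensity, Real.log_div (by positivity) (by positivity),
        Real.log_mul (by positivity) (by positivity), Real.log_mul (by positivity) (by positivity),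
        Real.log_exp, Real.log_exp, Real.log_rpow hc, Real.log_rpow hc2,
        Real.log_mul (by positivity) hpos.ne', Real.log_mul hp.ne' (by positivity), Real.log_pow]
      have e1 : x + WithLp.toLp 2 (A.mulVec z) - μ = v + WithLp.toLp 2 (A.mulVec z) := by
        rw [hv]; abel
      have e2 : ‖v + WithLp.toLp 2 (A.mulVec z)‖ ^ 2 =
          ‖v‖ ^ 2 + 2 * (∑ i, v i * A.mulVec z i) + ∑ i, A.mulVec z i * A.mulVec z i := by
        simp only [EuclideanSpace.real_norm_sq_eq, Finset.mul_sum, ← Finset.sum_add_distrib]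
        exact Finset.sum_congr rfl fun i _ => by simp; ring
      have e3 : ∑ i, v i * A.mulVec z i = ∑ j, (∑ i, v i * A i j) * z j := by
        simp only [Matrix.mulVec, dotProduct, Finset.mul_sum, Finset.sum_mul]
        rw [Finset.sum_comm]
        exact Finset.sum_congr rfl fun i _ => Finset.sum_congr rfl fun j _ => by ring
      have e4 : ∑ i, A.mulVec z i * A.mulVec z i =
          ∑ j, ∑ k, (A.transpose * A) j k * (z j * z k) := by
        simp only [Matrix.mulVec, dotProduct, Finset.mul_sum, Finset.sum_mul, Matrix.mul_apply,
          Matrix.transpose_apply]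
        rw [Finset.sum_comm]
        refine Finset.sum_congr rfl fun j _ => ?_
        rw [Finset.sum_comm]
        exact Finset.sum_congr rfl fun i _ => Finset.sum_congr rfl fun k _ => by ring
      have e5 : ∑ j, ∑ k, ((-(1/2 : ℝ)) • (1 : Matrix (Fin n) (Fin n) ℝ) +
          (1 / (2 * σ ^ 2)) • (A.transpose * A)) j k * (z j * z k) =
          -(1/2 : ℝ) * ∑ i, z i * z i +
            (1 / (2 * σ ^ 2)) * ∑ j, ∑ k, (A.transpose * A) j k * (z j * z k) := by
        simp only [Matrix.add_apply, Matrix.smul_apply, smul_eq_mul, add_mul,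
          Finset.sum_add_distrib, Finset.mul_sum, Matrix.one_apply]
        congr 1
        · simp
        · exact Finset.sum_congr rfl fun i _ => Finset.sum_congr rfl fun j _ => by ring
      have e6 : ∑ j, ((1 / σ ^ 2) * ∑ i, v i * A i j) * z j =
          (1 / σ ^ 2) * ∑ j, (∑ i, v i * A i j) * z j := by
        rw [Finset.mul_sum]; exact Finset.sum_congr rfl fun i _ => by ring
      rw [e1, e2, e5, e6, ← e3, ← e4]
      field_simp
      ring
  simp_rw [key]
  rw [poly, Matrix.trace_add, Matrix.trace_smul, Matrix.trace_smul, Matrix.trace_mul_comm, ← hSA,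
    Matrix.trace_one]
  simp only [smul_eq_mul, Fintype.card_fin]
  field_simp
  ring

end KM

/-- The total distortion `Σ_d KL( N(x_d, Σ) ‖ N(μ_{f(d)}, σ²I) )` equals
`(1/(2σ²)) · Σ_d ‖x_d − μ_{f(d)}‖² + |D| · ½ · (n·log σ² − log det Σ − n + tr Σ / σ²)`;
in particular, it depends on `f` and `μ` only through the k-means objective. -/
theorem total_distortion_eq_kmeans_objective {n : ℕ} (hn : 0 < n)
    {D ι : Type*} [Fintype D] [Nonempty D] [Fintype ι]
    (x : D → EuclideanSpace ℝ (Fin n)) (μ : ι → EuclideanSpace ℝ (Fin n)) (f : D → ι)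
    (S : Matrix (Fin n) (Fin n) ℝ) (hSsymm : S.IsSymm) (hS : S.PosDef)
    (σ : ℝ) (hσ : 0 < σ) :
    ∑ d : D, ∫ q : EuclideanSpace ℝ (Fin n),
        gaussianDensity (x d) S q *
          Real.log (gaussianDensity (x d) S q / isoGaussianDensity (μ (f d)) σ q) =
    (1 / (2 * σ ^ 2)) * ∑ d : D, ‖x d - μ (f d)‖ ^ 2 +
      (Fintype.card D : ℝ) * ((1 / 2 : ℝ) *
        ((n : ℝ) * Real.log (σ ^ 2) - Real.log S.det - (n : ℝ) + S.trace / σ ^ 2)) := by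
  simp_rw [KM.single S hS σ hσ]
  rw [Finset.sum_add_distrib, ← Finset.mul_sum]
  simp
end
end

section
/- Let n be a positive natural number, D a finite nonempty type, ι a finite type, x : D → EuclideanSpace ℝ (Fin n), and for an assignment f : D → ι with all used clusters nonempty let S(f) = Σ_{i ∈ ι} Σ_{d ∈ f⁻¹(i)} ‖x_d − c_i(f)‖², where c_i(f) is the centroid of cluster f⁻¹(i). If f* minimizes S over all assignments D → ι with nonempty used clusters, then for every constant c > 0 the pair (f*, centroids of f*) maximizes the likelihood functional L(f, μ) = exp( −c · Σ_{d ∈ D} ‖x_d − μ_{f(d)}‖² ) over all assignments f : D → ι and all center families μ : ι → EuclideanSpace ℝ (Fin n). (This is the reduction showing that any optimal k-means clustering is a bottleneck-minimal indexing under Gaussian assumptions on p(Q|document) and p(Q|index).) -/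
noncomputable section

open scoped BigOperators

/-- The centroid of cluster `f⁻¹(i)`: the arithmetic mean of `{x_d : f(d) = i}`. -/
def centroid {n : ℕ} {D ι : Type*} [Fintype D] [DecidableEq ι]
    (x : D → EuclideanSpace ℝ (Fin n)) (f : D → ι) (i : ι) :
    EuclideanSpace ℝ (Fin n) :=
  ((Finset.univ.filter (fun d => f d = i)).card : ℝ)⁻¹ •
    ∑ d ∈ Finset.univ.filter (fun d => f d = i), x d

/-- The k-means objective `S(f) = Σ_i Σ_{d ∈ f⁻¹(i)} ‖x_d − c_i(f)‖²` evaluated at the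
centroids of the assignment `f`. -/
def kmeansObjective {n : ℕ} {D ι : Type*} [Fintype D] [Fintype ι] [DecidableEq ι]
    (x : D → EuclideanSpace ℝ (Fin n)) (f : D → ι) : ℝ :=
  ∑ i : ι, ∑ d ∈ Finset.univ.filter (fun d => f d = i), ‖x d - centroid x f i‖ ^ 2

/-- Regrouping a sum over documents by cluster. -/
theorem sum_by_cluster {n : ℕ} {D ι : Type*} [Fintype D] [Fintype ι] [DecidableEq ι]
    (x : D → EuclideanSpace ℝ (Fin n)) (f : D → ι) (μ : ι → EuclideanSpace ℝ (Fin n)) :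
    ∑ d : D, ‖x d - μ (f d)‖ ^ 2 =
      ∑ i : ι, ∑ d ∈ Finset.univ.filter (fun d => f d = i), ‖x d - μ i‖ ^ 2 := by
  rw [← Finset.sum_fiberwise Finset.univ f]
  refine Finset.sum_congr rfl fun i _ => Finset.sum_congr rfl fun d hd => ?_
  rw [(Finset.mem_filter.mp hd).2]

/-- The centroid minimizes the within-cluster sum of squares. -/
theorem centroid_le {n : ℕ} {D ι : Type*} [Fintype D] [DecidableEq ι]
    (x : D → EuclideanSpace ℝ (Fin n)) (f : D → ι) (i : ι) (m : EuclideanSpace ℝ (Fin n)) :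
    ∑ d ∈ Finset.univ.filter (fun d => f d = i), ‖x d - centroid x f i‖ ^ 2 ≤
      ∑ d ∈ Finset.univ.filter (fun d => f d = i), ‖x d - m‖ ^ 2 := by
  have hz : ∑ d ∈ Finset.univ.filter (fun d => f d = i), (x d - centroid x f i) = 0 := by
    rw [Finset.sum_sub_distrib, Finset.sum_const, ← Nat.cast_smul_eq_nsmul ℝ, centroid]
    rcases Finset.eq_empty_or_nonempty (Finset.univ.filter (fun d => f d = i)) with h | h
    · simp [h]
    · have h0 : ((Finset.univ.filter (fun d => f d = i)).card : ℝ) ≠ 0 := by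
        exact_mod_cast h.card_pos.ne'
      rw [smul_smul, mul_inv_cancel₀ h0, one_smul, sub_self]
  have key : ∀ d, ‖x d - m‖ ^ 2 = ‖x d - centroid x f i‖ ^ 2
      + 2 * inner ℝ (x d - centroid x f i) (centroid x f i - m) + ‖centroid x f i - m‖ ^ 2 := by
    intro d
    rw [← norm_add_sq_real, sub_add_sub_cancel]
  simp_rw [key]
  rw [Finset.sum_add_distrib, Finset.sum_add_distrib, ← Finset.mul_sum, ← sum_inner, hz,
    inner_zero_left]
  have : 0 ≤ ∑ d ∈ Finset.univ.filter (fun d => f d = i), ‖centroid x f i - m‖ ^ 2 :=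
    Finset.sum_nonneg fun _ _ => by positivity
  linarith

/-- If `f*` minimizes the k-means objective `S` over all assignments, then for every
constant `c > 0`, the pair `(f*, centroids of f*)` maximizes the bottleneck likelihood
`L(f, μ) = exp(−c · Σ_d ‖x_d − μ_{f(d)}‖²)` over all assignments and center families:
any optimal k-means clustering is a bottleneck-minimal indexing under Gaussian
assumptions. -/
theorem kmeans_optimal_maximizes_likelihood {n : ℕ} (hn : 0 < n)
    {D ι : Type*} [Fintype D] [Nonempty D] [Fintype ι] [DecidableEq ι]
    (x : D → EuclideanSpace ℝ (Fin n)) (fstar : D → ι)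
    (hopt : ∀ f : D → ι, kmeansObjective x fstar ≤ kmeansObjective x f)
    (c : ℝ) (hc : 0 < c) :
    ∀ (f : D → ι) (μ : ι → EuclideanSpace ℝ (Fin n)),
      Real.exp (-c * ∑ d : D, ‖x d - μ (f d)‖ ^ 2) ≤
        Real.exp (-c * ∑ d : D, ‖x d - centroid x fstar (fstar d)‖ ^ 2) := by
  intro f μ
  have h1 : kmeansObjective x f ≤ ∑ d : D, ‖x d - μ (f d)‖ ^ 2 := by
    rw [sum_by_cluster, kmeansObjective]
    exact Finset.sum_le_sum fun i _ => centroid_le x f i (μ i)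
  have h2 : ∑ d : D, ‖x d - centroid x fstar (fstar d)‖ ^ 2 = kmeansObjective x fstar :=
    sum_by_cluster x fstar (centroid x fstar)
  rw [Real.exp_le_exp, h2]
  exact mul_le_mul_of_nonpos_left ((hopt f).trans h1) (by linarith)
end
end
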